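/- For every ε_1 ≠ 0, the Lie algebra g_{−1}(ε_1) is perfect: its derived algebra [g_{−1}(ε_1), g_{−1}(ε_1)] equals g_{−1}(ε_1). -/

import Mathlib

/-- The underlying space `ℝ⁸` of the family `g_α`. -/
abbrev V8 : Type := Fin 8 → ℝ

/-- The standard basis vector `X_{k+1}` (0-indexed: `e8 k`). -/
def e8 (k : Fin 8) : V8 := fun l => if l = k then 1 else 0

/-- Brackets of basis elements of `g_α` for `i < j` (0-indexed, `X_{i+1} = e8 i`):
`u α i j = [X_{i+1}, X_{j+1}]`. -/
noncomputable def gUpper (α : ℝ) : Fin 8 → Fin 8 → V8 := fun i j =>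
  match (i : ℕ), (j : ℕ) with
  | 0, 1 => (2 : ℝ) • e8 1          -- [X₁,X₂] = 2X₂
  | 0, 2 => (-2 : ℝ) • e8 2         -- [X₁,X₃] = −2X₃
  | 1, 2 => e8 0                    -- [X₂,X₃] = X₁
  | 0, 3 => e8 3                    -- [X₁,X₄] = X₄
  | 0, 4 => -e8 4                   -- [X₁,X₅] = −X₅
  | 0, 5 => e8 5                    -- [X₁,X₆] = X₆
  | 0, 6 => -e8 6                   -- [X₁,X₇] = −X₇
  | 1, 4 => e8 3                    -- [X₂,X₅] = X₄
  | 1, 6 => e8 5                    -- [X₂,X₇] = X₆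
  | 2, 3 => e8 4                    -- [X₃,X₄] = X₅
  | 2, 5 => e8 6                    -- [X₃,X₆] = X₇
  | 3, 7 => e8 3                    -- [X₄,X₈] = X₄
  | 4, 7 => e8 4                    -- [X₅,X₈] = X₅
  | 5, 7 => α • e8 5                -- [X₆,X₈] = αX₆
  | 6, 7 => α • e8 6                -- [X₇,X₈] = αX₇
  | _, _ => 0

/-- The structure constants `C_{ij}^k` of `g_α`. -/
noncomputable def gC (α : ℝ) (i j k : Fin 8) : ℝ := gUpper α i j k - gUpper α j i k

/-- The bilinear map on `ℝ⁸` with structure constants `C`. -/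
noncomputable def brOf (C : Fin 8 → Fin 8 → Fin 8 → ℝ) : V8 →ₗ[ℝ] V8 →ₗ[ℝ] V8 :=
  LinearMap.mk₂ ℝ (fun x y k => ∑ i, ∑ j, C i j k * x i * y j)
    (by
      intro x x' y
      funext k
      simp only [Pi.add_apply]
      rw [← Finset.sum_add_distrib]
      refine Finset.sum_congr rfl fun i _ => ?_
      rw [← Finset.sum_add_distrib]
      exact Finset.sum_congr rfl fun j _ => by ring)
    (by
      intro c x y
      funext k
      simp only [Pi.smul_apply, smul_eq_mul]
      rw [Finset.mul_sum]
      refine Finset.sum_congr rfl fun i _ => ?_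
      rw [Finset.mul_sum]
      exact Finset.sum_congr rfl fun j _ => by ring)
    (by
      intro x y y'
      funext k
      simp only [Pi.add_apply]
      rw [← Finset.sum_add_distrib]
      refine Finset.sum_congr rfl fun i _ => ?_
      rw [← Finset.sum_add_distrib]
      exact Finset.sum_congr rfl fun j _ => by ring)
    (by
      intro c x y
      funext k
      simp only [Pi.smul_apply, smul_eq_mul]
      rw [Finset.mul_sum]
      refine Finset.sum_congr rfl fun i _ => ?_
      rw [Finset.mul_sum]
      exact Finset.sum_congr rfl fun j _ => by ring)

/-- The Lie bracket `μ_α` of the Lie algebra `g_α`, as a bilinear map on `ℝ⁸`. -/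
noncomputable def brA (α : ℝ) : V8 →ₗ[ℝ] V8 →ₗ[ℝ] V8 := brOf (gC α)

/-- Values `φ₁(X_{i+1}, X_{j+1})` for `i < j` (0-indexed). -/
noncomputable def phi1Upper : Fin 8 → Fin 8 → V8 := fun i j =>
  match (i : ℕ), (j : ℕ) with
  | 3, 5 => e8 1                                        -- φ₁(X₄,X₆) = X₂
  | 3, 6 => (-(1:ℝ)/2) • e8 0 + ((3:ℝ)/2) • e8 7        -- φ₁(X₄,X₇) = −½X₁+³⁄₂X₈
  | 4, 5 => (-(1:ℝ)/2) • e8 0 - ((3:ℝ)/2) • e8 7        -- φ₁(X₅,X₆) = −½X₁−³⁄₂X₈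
  | 4, 6 => -e8 2                                       -- φ₁(X₅,X₇) = −X₃
  | _, _ => 0

/-- The alternating bilinear map `φ₁` on `ℝ⁸`. -/
noncomputable def phi1 : V8 →ₗ[ℝ] V8 →ₗ[ℝ] V8 :=
  brOf (fun i j k => phi1Upper i j k - phi1Upper j i k)

/-- Values `φ₂(X_{i+1}, X_{j+1})` for `i < j` (0-indexed). -/
noncomputable def phi2Upper : Fin 8 → Fin 8 → V8 := fun i j =>
  match (i : ℕ), (j : ℕ) with
  | 5, 7 => e8 5                                        -- φ₂(X₆,X₈) = X₆
  | 6, 7 => e8 6                                        -- φ₂(X₇,X₈) = X₇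
  | _, _ => 0

/-- The alternating bilinear map `φ₂` on `ℝ⁸`. -/
noncomputable def phi2 : V8 →ₗ[ℝ] V8 →ₗ[ℝ] V8 :=
  brOf (fun i j k => phi2Upper i j k - phi2Upper j i k)

theorem brOf_e8 (C : Fin 8 → Fin 8 → Fin 8 → ℝ) (i j : Fin 8) :
    brOf C (e8 i) (e8 j) = C i j := by
  funext k
  simp [brOf, e8]

/-- The bracket of two basis vectors of `g_{−1}(ε)`. -/
theorem deformed_bracket_e8 (ε : ℝ) (i j : Fin 8) :
    (brA (-1) + ε • phi1) (e8 i) (e8 j) =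
      (gUpper (-1) i j - gUpper (-1) j i) + ε • (phi1Upper i j - phi1Upper j i) := by
  simp only [LinearMap.add_apply, LinearMap.smul_apply, brA, phi1, brOf_e8]
  rfl

theorem span_eq_top_of_e8_mem (S : Submodule ℝ V8) (h : ∀ k, e8 k ∈ S) : S = ⊤ := by
  refine Submodule.eq_top_iff'.2 fun x => ?_
  have hx : x = ∑ k, x k • e8 k := by
    funext l
    simp [e8]
  rw [hx]
  exact S.sum_mem fun k _ => S.smul_mem _ (h k)

/-- For `ε₁ ≠ 0` the deformed Lie algebra `g_{−1}(ε₁) = (ℝ⁸, μ_{−1} + ε₁φ₁)` is perfect: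
its derived algebra is the whole algebra. -/
theorem deformed_algebra_is_perfect (ε₁ : ℝ) (hε : ε₁ ≠ 0) :
    Submodule.span ℝ {z : V8 | ∃ x y : V8, z = (brA (-1) + ε₁ • phi1) x y} = ⊤ := by
  set S := Submodule.span ℝ {z : V8 | ∃ x y : V8, z = (brA (-1) + ε₁ • phi1) x y}
  have hmem (i j : Fin 8) :
      (gUpper (-1) i j - gUpper (-1) j i) + ε₁ • (phi1Upper i j - phi1Upper j i) ∈ S :=
    Submodule.subset_span ⟨e8 i, e8 j, (deformed_bracket_e8 ε₁ i j).symm⟩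
  have h0 : e8 0 ∈ S := by simpa [gUpper, phi1Upper] using hmem 1 2
  have h1 : e8 1 ∈ S := by
    have h := S.smul_mem (1 / 2 : ℝ) (hmem 0 1)
    simpa [gUpper, phi1Upper, smul_smul] using h
  have h2 : e8 2 ∈ S := by
    have h := S.smul_mem (-1 / 2 : ℝ) (hmem 0 2)
    simpa [gUpper, phi1Upper, smul_smul] using h
  have h3 : e8 3 ∈ S := by simpa [gUpper, phi1Upper] using hmem 0 3
  have h4 : e8 4 ∈ S := by simpa [gUpper, phi1Upper] using hmem 0 4
  have h5 : e8 5 ∈ S := by simpa [gUpper, phi1Upper] using hmem 0 5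
  have h6 : e8 6 ∈ S := by simpa [gUpper, phi1Upper] using hmem 0 6
  have h7 : e8 7 ∈ S := by
    have h : ε₁ • ((-(1 : ℝ) / 2) • e8 0 + ((3 : ℝ) / 2) • e8 7) ∈ S := by
      simpa [gUpper, phi1Upper] using hmem 3 6
    have h' := (S.smul_mem_iff hε).1 h
    rw [S.add_mem_iff_right (S.smul_mem _ h0)] at h'
    exact (S.smul_mem_iff (by norm_num)).1 h'
  refine span_eq_top_of_e8_mem S fun k => ?_
  fin_cases k <;> assumption
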